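/- arXiv:1404.3548 — 4 statements merged into one kernel-verified Lean document; each statement's English description precedes it below -/
import Mathlib

section
/- The groups G₁ and G₂ are not isomorphic, where G₁ = ⟨A, B ∣ A⁻¹B⁻¹A²B²⟩ and G₂ = ⟨A, B ∣ AB⁻¹A²B²⟩. -/
/-- The relator `A⁻¹ B⁻¹ A² B²` in the free group on two generators `A = of 0`, `B = of 1`. -/
abbrev rel₁ : Set (FreeGroup (Fin 2)) :=
  {(FreeGroup.of 0)⁻¹ * (FreeGroup.of 1)⁻¹ * FreeGroup.of 0 ^ 2 * FreeGroup.of 1 ^ 2}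

/-- The relator `A B⁻¹ A² B²` in the free group on two generators `A = of 0`, `B = of 1`. -/
abbrev rel₂ : Set (FreeGroup (Fin 2)) :=
  {FreeGroup.of 0 * (FreeGroup.of 1)⁻¹ * FreeGroup.of 0 ^ 2 * FreeGroup.of 1 ^ 2}

/-- `G₁ = ⟨A, B ∣ A⁻¹B⁻¹A²B²⟩` -/
abbrev G₁ : Type := PresentedGroup rel₁

/-- `G₂ = ⟨A, B ∣ AB⁻¹A²B²⟩` -/
abbrev G₂ : Type := PresentedGroup rel₂

/-- A homomorphism out of a presented group has commutative image as soon as the images of the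
generators commute. -/
theorem PresentedGroup.commute_map_of_commute_map_generators {α H : Type*} [Group H]
    {rels : Set (FreeGroup α)} (f : PresentedGroup rels →* H)
    (h : ∀ i j, Commute (f (PresentedGroup.of i)) (f (PresentedGroup.of j)))
    (x y : PresentedGroup rels) : Commute (f x) (f y) := by
  have extend (c : H) (hc : ∀ i, Commute c (f (PresentedGroup.of i)))
      (z : PresentedGroup rels) : Commute c (f z) := by
    have hconj : (MulAut.conj c).toMonoidHom.comp f = f :=
      PresentedGroup.ext fun i => by simpa using (hc i).mul_inv_cancel
    simpa [mul_inv_eq_iff_eq_mul, commute_iff_eq] using DFunLike.congr_fun hconj z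
  exact extend _ (fun i => (extend _ (h i) x).symm) y

/-- Solutions of the relation of `G₂` in the symmetric group on four letters commute. -/
theorem commute_of_rel₂_perm_four : ∀ a b : Equiv.Perm (Fin 4),
    a * b⁻¹ * a ^ 2 * b ^ 2 = 1 → a * b = b * a := by
  decide +kernel

theorem commute_map_G₂_perm_four (f : G₂ →* Equiv.Perm (Fin 4)) (x y : G₂) :
    Commute (f x) (f y) := by
  have hrel : f (PresentedGroup.of 0) * (f (PresentedGroup.of 1))⁻¹ *
      f (PresentedGroup.of 0) ^ 2 * f (PresentedGroup.of 1) ^ 2 = 1 := by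
    simpa [PresentedGroup.of] using congrArg f (PresentedGroup.one_of_mem (rels := rel₂) rfl)
  have hcomm : Commute (f (PresentedGroup.of 0)) (f (PresentedGroup.of 1)) :=
    commute_of_rel₂_perm_four _ _ hrel
  refine PresentedGroup.commute_map_of_commute_map_generators f (fun i j => ?_) x y
  fin_cases i <;> fin_cases j
  exacts [.refl _, hcomm, hcomm.symm, .refl _]

/-- The images of the generators under a homomorphism from `G₁` onto the alternating group on
four letters. -/
def permFourOfGenerator : Fin 2 → Equiv.Perm (Fin 4) :=
  ![Equiv.swap 0 1 * Equiv.swap 1 2,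
    Equiv.swap 0 1 * Equiv.swap 2 3 * (Equiv.swap 0 1 * Equiv.swap 1 2)⁻¹]

theorem exists_not_commute_map_G₁_perm_four :
    ∃ (f : G₁ →* Equiv.Perm (Fin 4)) (x y : G₁), ¬ Commute (f x) (f y) := by
  have hrel : ∀ r ∈ rel₁, FreeGroup.lift permFourOfGenerator r = 1 := by
    rintro r rfl
    simp only [map_mul, map_inv, map_pow, FreeGroup.lift_apply_of]
    decide +kernel
  refine ⟨PresentedGroup.toGroup hrel, .of 0, .of 1, ?_⟩
  simp only [PresentedGroup.toGroup.of, commute_iff_eq]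
  decide +kernel

theorem stmt_2 : IsEmpty (G₁ ≃* G₂) := by
  refine ⟨fun e => ?_⟩
  obtain ⟨f, x, y, hxy⟩ := exists_not_commute_map_G₁_perm_four
  refine hxy ?_
  simpa using commute_map_G₂_perm_four (f.comp e.symm.toMonoidHom) (e x) (e y)
end

section
/- There is no surjective group homomorphism from G₂ = ⟨A, B ∣ AB⁻¹A²B²⟩ onto the alternating group A₄ on four letters. -/
/-- If the images of the two generators commute, then a surjection from `G₂` has commutative
target. -/
theorem G₂.mul_comm_of_surjective {H : Type*} [Group H] {f : G₂ →* H}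
    (hf : Function.Surjective f)
    (h : Commute (f (PresentedGroup.of 0)) (f (PresentedGroup.of 1))) (x y : H) :
    x * y = y * x := by
  have conj_eq (z : H) (hz : ∀ i : Fin 2, Commute z (f (PresentedGroup.of i))) :
      (MulAut.conj z).toMonoidHom.comp f = f :=
    PresentedGroup.ext fun i => by simp [(hz i).eq]
  have commute_of (z : H) (hz : ∀ i : Fin 2, Commute z (f (PresentedGroup.of i))) (y : H) :
      Commute z y := by
    obtain ⟨w, rfl⟩ := hf y
    exact mul_inv_eq_iff_eq_mul.mp (DFunLike.congr_fun (conj_eq z hz) w)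
  have central (i : Fin 2) (y : H) : Commute (f (PresentedGroup.of i)) y := by
    refine commute_of _ (fun j => ?_) y
    fin_cases i <;> fin_cases j
    exacts [Commute.refl _, h, h.symm, Commute.refl _]
  exact commute_of x (fun i => (central i x).symm) y

set_option maxRecDepth 100000 in
theorem alternatingGroup_four_commute_of_relation :
    ∀ a b : alternatingGroup (Fin 4), a * b⁻¹ * a ^ 2 * b ^ 2 = 1 → a * b = b * a := by
  decide

theorem stmt_4 :
    ¬ ∃ f : G₂ →* alternatingGroup (Fin 4), Function.Surjective f := by
  rintro ⟨f, hf⟩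
  have hrel : (PresentedGroup.of 0 * (PresentedGroup.of 1)⁻¹ * PresentedGroup.of 0 ^ 2 *
      PresentedGroup.of 1 ^ 2 : G₂) = 1 :=
    PresentedGroup.one_of_mem (rels := rel₂) rfl
  have hcomm : Commute (f (PresentedGroup.of 0)) (f (PresentedGroup.of 1)) :=
    alternatingGroup_four_commute_of_relation _ _ (by simpa using congrArg f hrel)
  have hnot : ¬ ∀ x y : alternatingGroup (Fin 4), x * y = y * x := by decide
  exact hnot (G₂.mul_comm_of_surjective hf hcomm)
end

section
/- The presented group ⟨α, β ∣ αβα²β⁻²α⁻²⟩ (quotient of the free group on two generators α, β by the normal closure of the relator αβα²β⁻²α⁻²) is isomorphic to G₁ = ⟨A, B ∣ A⁻¹B⁻¹A²B²⟩, via an isomorphism sending the class of α to A and the class of α⁻²β⁻¹α² to B. -/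
/-- The relator `αβα²β⁻²α⁻²` in the free group on two generators `α = of 0`, `β = of 1`. -/
abbrev relαβ : Set (FreeGroup (Fin 2)) :=
  {FreeGroup.of 0 * FreeGroup.of 1 * FreeGroup.of 0 ^ 2 * (FreeGroup.of 1 ^ 2)⁻¹ *
    (FreeGroup.of 0 ^ 2)⁻¹}

theorem G₁_relation :
    (PresentedGroup.of 0 : G₁)⁻¹ * (PresentedGroup.of 1)⁻¹ * PresentedGroup.of 0 ^ 2 *
      PresentedGroup.of 1 ^ 2 = 1 :=
  PresentedGroup.one_of_mem (rels := rel₁) rfl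

theorem relαβ_relation :
    (PresentedGroup.of 0 : PresentedGroup relαβ) * PresentedGroup.of 1 * PresentedGroup.of 0 ^ 2 *
      (PresentedGroup.of 1 ^ 2)⁻¹ * (PresentedGroup.of 0 ^ 2)⁻¹ = 1 :=
  PresentedGroup.one_of_mem (rels := relαβ) rfl

/-- The homomorphism to `G₁` with `α ↦ A` and `β ↦ A²B⁻¹A⁻²`. -/
def toG₁ : PresentedGroup relαβ →* G₁ :=
  PresentedGroup.toGroup
    (f := ![PresentedGroup.of 0,
      PresentedGroup.of 0 ^ 2 * (PresentedGroup.of 1)⁻¹ * (PresentedGroup.of 0 ^ 2)⁻¹]) (by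
    rintro r rfl
    have h := congrArg (fun x => PresentedGroup.of 0 ^ 4 * x * (PresentedGroup.of 0 ^ 4)⁻¹)
      G₁_relation
    simp only [mul_one, mul_inv_cancel] at h
    simp only [map_mul, map_inv, map_pow, FreeGroup.lift_apply_of, Matrix.cons_val_zero,
      Matrix.cons_val_one]
    rw [← h]
    simp only [pow_two (_ * _)]
    group)

/-- The homomorphism from `G₁` with `A ↦ α` and `B ↦ α⁻²β⁻¹α²`. -/
def ofG₁ : G₁ →* PresentedGroup relαβ :=
  PresentedGroup.toGroup
    (f := ![PresentedGroup.of 0,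
      (PresentedGroup.of 0 ^ 2)⁻¹ * (PresentedGroup.of 1)⁻¹ * PresentedGroup.of 0 ^ 2]) (by
    rintro r rfl
    have h := congrArg (fun x => (PresentedGroup.of 0 ^ 4)⁻¹ * x * PresentedGroup.of 0 ^ 4)
      relαβ_relation
    simp only [mul_one, inv_mul_cancel] at h
    simp only [map_mul, map_inv, map_pow, FreeGroup.lift_apply_of, Matrix.cons_val_zero,
      Matrix.cons_val_one]
    rw [← h]
    simp only [pow_two (_ * _)]
    group)

@[simp] theorem toG₁_of_zero : toG₁ (PresentedGroup.of 0) = PresentedGroup.of 0 :=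
  PresentedGroup.toGroup.of _

@[simp] theorem toG₁_of_one : toG₁ (PresentedGroup.of 1) =
    PresentedGroup.of 0 ^ 2 * (PresentedGroup.of 1)⁻¹ * (PresentedGroup.of 0 ^ 2)⁻¹ :=
  PresentedGroup.toGroup.of _

@[simp] theorem ofG₁_of_zero : ofG₁ (PresentedGroup.of 0) = PresentedGroup.of 0 :=
  PresentedGroup.toGroup.of _

@[simp] theorem ofG₁_of_one : ofG₁ (PresentedGroup.of 1) =
    (PresentedGroup.of 0 ^ 2)⁻¹ * (PresentedGroup.of 1)⁻¹ * PresentedGroup.of 0 ^ 2 :=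
  PresentedGroup.toGroup.of _

theorem ofG₁_comp_toG₁ : ofG₁.comp toG₁ = MonoidHom.id _ :=
  PresentedGroup.ext fun i => by
    fin_cases i
    · simp
    · simp [mul_assoc]

theorem toG₁_comp_ofG₁ : toG₁.comp ofG₁ = MonoidHom.id _ :=
  PresentedGroup.ext fun i => by
    fin_cases i
    · simp
    · simp [mul_assoc]

theorem stmt_10 :
    ∃ e : PresentedGroup relαβ ≃* G₁,
      e (PresentedGroup.of 0) = PresentedGroup.of 0 ∧
      e ((PresentedGroup.of 0 ^ 2)⁻¹ * (PresentedGroup.of 1)⁻¹ * PresentedGroup.of 0 ^ 2) =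
        PresentedGroup.of 1 := by
  refine ⟨toG₁.toMulEquiv ofG₁ ofG₁_comp_toG₁ toG₁_comp_ofG₁, toG₁_of_zero, ?_⟩
  simp [mul_assoc]
end

section
/- The presented group ⟨γ, δ ∣ δ²γδγ⁻¹δ²γ⟩ (quotient of the free group on two generators γ, δ by the normal closure of the relator δ²γδγ⁻¹δ²γ) is isomorphic to G₂ = ⟨A, B ∣ AB⁻¹A²B²⟩, via an isomorphism sending the class of δ to A and the class of δ²γ to a conjugate of B. -/
/-- The relator `δ²γδγ⁻¹δ²γ` in the free group on two generators `γ = of 0`, `δ = of 1`. -/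
abbrev relγδ : Set (FreeGroup (Fin 2)) :=
  {FreeGroup.of 1 ^ 2 * FreeGroup.of 0 * FreeGroup.of 1 * (FreeGroup.of 0)⁻¹ *
    FreeGroup.of 1 ^ 2 * FreeGroup.of 0}

theorem G₂_relation :
    (PresentedGroup.of 0 * (PresentedGroup.of 1)⁻¹ * PresentedGroup.of 0 ^ 2 *
      PresentedGroup.of 1 ^ 2 : G₂) = 1 :=
  PresentedGroup.one_of_mem (rels := rel₂) rfl

theorem γδ_relation :
    (PresentedGroup.of 1 ^ 2 * PresentedGroup.of 0 * PresentedGroup.of 1 *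
      (PresentedGroup.of 0)⁻¹ * PresentedGroup.of 1 ^ 2 * PresentedGroup.of 0 :
        PresentedGroup relγδ) = 1 :=
  PresentedGroup.one_of_mem (rels := relγδ) rfl

/-- The homomorphism with `γ ↦ A⁻²B` and `δ ↦ A`. -/
def γδToG₂ : PresentedGroup relγδ →* G₂ :=
  PresentedGroup.toGroup
    (f := ![(PresentedGroup.of 0 ^ 2)⁻¹ * PresentedGroup.of 1, PresentedGroup.of 0]) <| by
      rintro _ rfl
      simp only [map_mul, map_inv, map_pow, FreeGroup.lift_apply_of, Matrix.cons_val_zero,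
        Matrix.cons_val_one]
      rw [← conj_eq_one_iff (a := (PresentedGroup.of 1 : G₂)⁻¹), ← G₂_relation]
      simp [pow_two, mul_assoc]

/-- The homomorphism with `A ↦ δ` and `B ↦ δ²γ`. -/
def G₂Toγδ : G₂ →* PresentedGroup relγδ :=
  PresentedGroup.toGroup
    (f := ![PresentedGroup.of 1, PresentedGroup.of 1 ^ 2 * PresentedGroup.of 0]) <| by
      rintro _ rfl
      simp only [map_mul, map_inv, map_pow, FreeGroup.lift_apply_of, Matrix.cons_val_zero,
        Matrix.cons_val_one]
      rw [← conj_eq_one_iff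
        (a := (PresentedGroup.of 1 ^ 2 * PresentedGroup.of 0 : PresentedGroup relγδ)),
        ← γδ_relation]
      simp [pow_two, mul_assoc]

/-- The isomorphism with `γ ↦ A⁻²B` and `δ ↦ A`. -/
def γδEquivG₂ : PresentedGroup relγδ ≃* G₂ :=
  γδToG₂.toMulEquiv G₂Toγδ
    (by ext i; fin_cases i <;> simp [γδToG₂, G₂Toγδ])
    (by ext i; fin_cases i <;> simp [γδToG₂, G₂Toγδ])

theorem stmt_11 :
    ∃ e : PresentedGroup relγδ ≃* G₂,
      e (PresentedGroup.of 1) = PresentedGroup.of 0 ∧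
      ∃ w : G₂, e (PresentedGroup.of 1 ^ 2 * PresentedGroup.of 0) =
        w * PresentedGroup.of 1 * w⁻¹ := by
  refine ⟨γδEquivG₂, ?_, 1, ?_⟩ <;> simp [γδEquivG₂, γδToG₂]
end
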